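/- Let P' ⊆ ℝ^p be a nonempty 0/1-polytope and let (a, β) induce a symmetry of the cube with P' ⊆ H^≤(a,β) = {x : ⟨a,x⟩ ≤ β}. Let φ_H be the reflection through H = {x : ⟨a,x⟩ = β}. Then xcs(conv(P' ∪ φ_H(P'))) ≤ xcs(P') + 2. -/

import Mathlib

/-- A 0/1-vector. -/
def IsZeroOneVec {ι : Type*} (x : ι → ℝ) : Prop := ∀ i, x i = 0 ∨ x i = 1

/-- A 0/1-polytope: the convex hull of a set of 0/1-vectors. -/
def IsZeroOnePolytope {ι : Type*} (Q : Set (ι → ℝ)) : Prop :=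
  ∃ V : Set (ι → ℝ), (∀ x ∈ V, IsZeroOneVec x) ∧ Q = convexHull ℝ V

/-- `(Q, π)` is a nice 0/1-extension of `P`: `Q` is a 0/1-polytope, `π(Q) = P`,
every vertex (extreme point) of `Q` projects to a vertex of `P`, and each vertex
of `P` has exactly one vertex of `Q` projecting onto it. -/
def IsNiceExtension {p : ℕ} {ι : Type*} (P : Set (Fin p → ℝ)) (Q : Set (ι → ℝ))
    (π : (ι → ℝ) →ₗ[ℝ] (Fin p → ℝ)) : Prop :=
  IsZeroOnePolytope Q ∧ π '' Q = P ∧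
    (∀ y ∈ Set.extremePoints ℝ Q, π y ∈ Set.extremePoints ℝ P) ∧
    (∀ v ∈ Set.extremePoints ℝ P, ∃! y, y ∈ Set.extremePoints ℝ Q ∧ π y = v)

/-- `P` has a nice 0/1-extension `(Q, π)` where `Q` is described by `m` linear
inequalities together with finitely many linear equations. -/
def HasNiceDescrOfSize {p : ℕ} (P : Set (Fin p → ℝ)) (m : ℕ) : Prop :=
  ∃ (q s : ℕ) (A : Matrix (Fin m) (Fin q) ℝ) (b : Fin m → ℝ)
    (C : Matrix (Fin s) (Fin q) ℝ) (d : Fin s → ℝ)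
    (π : (Fin q → ℝ) →ₗ[ℝ] (Fin p → ℝ)),
    IsNiceExtension P {y | A.mulVec y ≤ b ∧ C.mulVec y = d} π

/-- The smallest size of a description of `Q` over all nice 0/1-extensions `(Q, π)` of `P`. -/
noncomputable def xcs {p : ℕ} (P : Set (Fin p → ℝ)) : ℕ :=
  sInf {m | HasNiceDescrOfSize P m}

/-- `(a, β)` induces a symmetry of the cube: either a coordinate flip
(`a = 2σ eᵢ`, `β = σ`) or a coordinate swap (`a = σ(eᵢ - eⱼ)`, `β = 0`),
with `σ ∈ {+1, -1}`. -/
def InducesCubeSymmetry {p : ℕ} (a : Fin p → ℝ) (β : ℝ) : Prop :=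
  (∃ (i : Fin p) (σ : ℝ), (σ = 1 ∨ σ = -1) ∧
    a = (2 * σ) • (Pi.single i 1 : Fin p → ℝ) ∧ β = σ) ∨
  (∃ (i j : Fin p) (σ : ℝ), i ≠ j ∧ (σ = 1 ∨ σ = -1) ∧
    a = σ • ((Pi.single i 1 : Fin p → ℝ) - (Pi.single j 1 : Fin p → ℝ)) ∧ β = 0)

theorem IsZeroOneVec.mem_Icc {ι : Type*} {x : ι → ℝ} (hx : IsZeroOneVec x) (i : ι) :
    x i ∈ Set.Icc (0 : ℝ) 1 := by
  rcases hx i with h | h <;> simp [h]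

theorem convexHull_apply_mem_Icc {ι : Type*} {V : Set (ι → ℝ)} (hV : ∀ x ∈ V, IsZeroOneVec x)
    {x : ι → ℝ} (hx : x ∈ convexHull ℝ V) (i : ι) : x i ∈ Set.Icc (0 : ℝ) 1 := by
  have hconv : Convex ℝ {x : ι → ℝ | x i ∈ Set.Icc (0 : ℝ) 1} :=
    (convex_Icc (0 : ℝ) 1).linear_preimage (LinearMap.proj i : (ι → ℝ) →ₗ[ℝ] ℝ)
  exact convexHull_min (fun x hx => (hV x hx).mem_Icc i) hconv hx

/-- A set of 0/1-vectors is in convex position. -/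
theorem extremePoints_convexHull_of_isZeroOneVec {ι : Type*} {V : Set (ι → ℝ)}
    (hV : ∀ x ∈ V, IsZeroOneVec x) : (convexHull ℝ V).extremePoints ℝ = V := by
  refine Set.Subset.antisymm extremePoints_convexHull_subset fun v hv => ?_
  refine ⟨subset_convexHull ℝ V hv, fun x hx y hy hxy => ?_⟩
  obtain ⟨s, t, hs, ht, hst, rfl⟩ := hxy
  funext i
  have hxi := convexHull_apply_mem_Icc hV hx i
  have hyi := convexHull_apply_mem_Icc hV hy i
  have hvi := hV _ hv i
  simp only [Pi.add_apply, Pi.smul_apply, smul_eq_mul, Set.mem_Icc] at hxi hyi hvi ⊢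
  obtain rfl : t = 1 - s := by linarith
  rcases hvi with h | h
  · have h1 : s * x i = 0 := by nlinarith [mul_nonneg hs.le hxi.1, mul_nonneg ht.le hyi.1]
    have := (mul_eq_zero.mp h1).resolve_left hs.ne'
    rw [h, this]
  · have h1 : s * (1 - x i) = 0 := by
      nlinarith [mul_nonneg hs.le (sub_nonneg.2 hxi.2), mul_nonneg ht.le (sub_nonneg.2 hyi.2)]
    have := (mul_eq_zero.mp h1).resolve_left hs.ne'
    rw [h]; linarith

/-- A linear map that is bijective between sets of 0/1-vectors is a nice extension of the
convex hulls. -/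
theorem isNiceExtension_convexHull {p : ℕ} {ι : Type*} {V : Set (Fin p → ℝ)} {W : Set (ι → ℝ)}
    {π : (ι → ℝ) →ₗ[ℝ] (Fin p → ℝ)} (hV : ∀ x ∈ V, IsZeroOneVec x)
    (hW : ∀ x ∈ W, IsZeroOneVec x) (hπ : Set.BijOn π W V) :
    IsNiceExtension (convexHull ℝ V) (convexHull ℝ W) π := by
  refine ⟨⟨W, hW, rfl⟩, by rw [π.image_convexHull, hπ.image_eq], ?_, ?_⟩
  · rw [extremePoints_convexHull_of_isZeroOneVec hV, extremePoints_convexHull_of_isZeroOneVec hW]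
    exact hπ.mapsTo
  · rw [extremePoints_convexHull_of_isZeroOneVec hV, extremePoints_convexHull_of_isZeroOneVec hW]
    intro v hv
    obtain ⟨w, hw, rfl⟩ := hπ.surjOn hv
    exact ⟨w, ⟨hw, rfl⟩, fun w' h => hπ.injOn h.1 hw h.2⟩

/-- Every nice extension of a 0/1-polytope arises from a bijection of sets of 0/1-vectors. -/
theorem IsNiceExtension.exists_bijOn {p : ℕ} {ι : Type*} {V : Set (Fin p → ℝ)} {Q : Set (ι → ℝ)}
    {π : (ι → ℝ) →ₗ[ℝ] (Fin p → ℝ)} (hV : ∀ x ∈ V, IsZeroOneVec x)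
    (h : IsNiceExtension (convexHull ℝ V) Q π) :
    ∃ W : Set (ι → ℝ), (∀ x ∈ W, IsZeroOneVec x) ∧ Q = convexHull ℝ W ∧ Set.BijOn π W V := by
  obtain ⟨⟨W, hW, rfl⟩, -, hmaps, huniq⟩ := h
  rw [extremePoints_convexHull_of_isZeroOneVec hV,
    extremePoints_convexHull_of_isZeroOneVec hW] at hmaps huniq
  exact ⟨W, hW, rfl, hmaps, fun x hx y hy hxy =>
      (huniq _ (hmaps y hy)).unique ⟨hx, hxy⟩ ⟨hy, rfl⟩,
    fun v hv => (huniq v hv).exists⟩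

theorem finite_setOf_isZeroOneVec {ι : Type*} [Finite ι] :
    {x : ι → ℝ | IsZeroOneVec x}.Finite := by
  refine (Set.Finite.pi' (t := fun _ : ι => ({0, 1} : Set ℝ)) fun _ => by simp).subset ?_
  intro x hx i
  simpa using hx i

/-- A 0/1-polytope is the projection of a simplex on its vertices. -/
theorem IsZeroOnePolytope.exists_hasNiceDescrOfSize {p : ℕ} {P : Set (Fin p → ℝ)}
    (hP : IsZeroOnePolytope P) : ∃ m, HasNiceDescrOfSize P m := by
  obtain ⟨V, hV, rfl⟩ := hP
  have hfin : V.Finite := finite_setOf_isZeroOneVec.subset hV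
  obtain ⟨n, v, hinj, rfl⟩ := hfin.fin_param
  let π : (Fin n → ℝ) →ₗ[ℝ] (Fin p → ℝ) := Fintype.linearCombination ℝ v
  have hπ : ∀ k, π (Pi.single k 1) = v k := fun k => by
    simp [π, Fintype.linearCombination_apply_single]
  refine ⟨n, n, 1, -1, 0, Matrix.of fun _ _ => 1, fun _ => 1, π, ?_⟩
  have hQ : {y : Fin n → ℝ | (-1 : Matrix (Fin n) (Fin n) ℝ).mulVec y ≤ 0 ∧
      (Matrix.of fun (_ : Fin 1) (_ : Fin n) => (1 : ℝ)).mulVec y = fun _ => 1} =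
      convexHull ℝ (Set.range fun k : Fin n => (Pi.single k 1 : Fin n → ℝ)) := by
    rw [convexHull_rangle_single_eq_stdSimplex]
    ext y
    simp [stdSimplex, Matrix.neg_mulVec, Pi.le_def, funext_iff, Matrix.mulVec, dotProduct]
  rw [hQ]
  refine isNiceExtension_convexHull hV ?_ ⟨?_, ?_, ?_⟩
  · rintro _ ⟨k, rfl⟩ i
    rcases eq_or_ne i k with rfl | h <;> simp [*]
  · rintro _ ⟨k, rfl⟩
    exact ⟨k, (hπ k).symm⟩
  · rintro _ ⟨k, rfl⟩ _ ⟨l, rfl⟩ h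
    simp only [hπ] at h
    rw [hinj h]
  · rintro _ ⟨k, rfl⟩
    exact ⟨_, ⟨k, rfl⟩, hπ k⟩

theorem Convex.preimage_of_map_combination {E F : Type*} [AddCommGroup E] [Module ℝ E]
    [AddCommGroup F] [Module ℝ F] {s : Set F} (hs : Convex ℝ s) {f : E → F}
    (hf : ∀ (x y : E) (r t : ℝ), r + t = 1 → f (r • x + t • y) = r • f x + t • f y) :
    Convex ℝ (f ⁻¹' s) := by
  intro x hx y hy r t hr ht hrt
  rw [Set.mem_preimage, hf x y r t hrt]
  exact hs hx hy hr ht hrt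

theorem InducesCubeSymmetry.sum_sq_ne_zero {p : ℕ} {a : Fin p → ℝ} {β : ℝ}
    (h : InducesCubeSymmetry a β) : (∑ i, a i ^ 2) ≠ 0 := by
  intro h0
  have ha : ∀ i, a i = 0 := fun i => by
    simpa using (Finset.sum_eq_zero_iff_of_nonneg fun i _ => sq_nonneg (a i)).1 h0 i
  rcases h with ⟨i, σ, hσ, rfl, -⟩ | ⟨i, j, σ, hij, hσ, rfl, -⟩ <;> have := ha i <;>
    rcases hσ with rfl | rfl <;> simp_all

/-- On 0/1-vectors in the halfspace, the slack is 0 or 1 and the reflected point is again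
a 0/1-vector. -/
theorem InducesCubeSymmetry.isZeroOneVec_reflection {p : ℕ} {a : Fin p → ℝ} {β : ℝ}
    (h : InducesCubeSymmetry a β) {x : Fin p → ℝ} (hx : IsZeroOneVec x)
    (hle : ∑ i, a i * x i ≤ β) :
    (β - ∑ i, a i * x i = 0 ∨ β - ∑ i, a i * x i = 1) ∧
      IsZeroOneVec (x + (β - ∑ i, a i * x i) • (2 / ∑ i, a i ^ 2) • a) := by
  rcases h with ⟨i, σ, hσ, rfl, rfl⟩ | ⟨i, j, σ, hij, hσ, rfl, rfl⟩
  · have h1 : ∑ k, ((2 * β) • (Pi.single i 1 : Fin p → ℝ)) k * x k = 2 * β * x i := by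
      simp [Pi.single_apply]
    have h2 : ∑ k, ((2 * β) • (Pi.single i 1 : Fin p → ℝ)) k ^ 2 = (2 * β) ^ 2 := by
      simp [Pi.single_apply, mul_pow]
    rw [h1] at hle ⊢
    rw [h2]
    rcases hσ with rfl | rfl <;> rcases hx i with hi | hi <;> rw [hi] at hle ⊢ <;>
      norm_num at hle <;> norm_num <;> intro k <;> rcases eq_or_ne k i with rfl | hk <;>
      simp [*] <;> exact hx k
  · have h1 : ∑ k, (σ • ((Pi.single i 1 : Fin p → ℝ) - (Pi.single j 1 : Fin p → ℝ)) :
        Fin p → ℝ) k * x k = σ * (x i - x j) := by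
      simp [Pi.single_apply, mul_sub, sub_mul, Finset.sum_sub_distrib]
    have h2 : ∑ k, (σ • ((Pi.single i 1 : Fin p → ℝ) - (Pi.single j 1 : Fin p → ℝ)) :
        Fin p → ℝ) k ^ 2 = 2 := by
      have hk : ∀ k, (σ • ((Pi.single i 1 : Fin p → ℝ) -
          (Pi.single j 1 : Fin p → ℝ)) : Fin p → ℝ) k ^ 2 =
          (Pi.single i 1 : Fin p → ℝ) k + (Pi.single j 1 : Fin p → ℝ) k := by
        intro k
        rcases hσ with rfl | rfl <;> rcases eq_or_ne k i with rfl | hki <;>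
          rcases eq_or_ne k j with rfl | hkj <;> simp_all
      simp only [hk, Finset.sum_add_distrib]
      simp [Pi.single_apply]; norm_num
    rw [h1] at hle ⊢
    rw [h2]
    rcases hσ with rfl | rfl <;> rcases hx i with hi | hi <;> rcases hx j with hj | hj <;>
      rw [hi, hj] at hle ⊢ <;> norm_num at hle <;> norm_num <;> try exact hx
    all_goals
      intro k
      rcases eq_or_ne k i with rfl | hki <;> rcases eq_or_ne k j with rfl | hkj <;> simp_all
      all_goals exact hx k

/-- A nice extension of `conv V` yields one of `conv (V ∪ φ V)` with two more inequalities, where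
`φ x = x + (β - ⟨a, x⟩) • c` and `⟨a, c⟩ = 2`. -/
theorem HasNiceDescrOfSize.convexHull_union_reflection {p m : ℕ} {V : Set (Fin p → ℝ)}
    (hV : ∀ x ∈ V, IsZeroOneVec x) (hm : HasNiceDescrOfSize (convexHull ℝ V) m)
    {a c : Fin p → ℝ} {β : ℝ} (hac : ∑ i, a i * c i = 2)
    (hslack : ∀ x ∈ V, β - ∑ i, a i * x i = 0 ∨ β - ∑ i, a i * x i = 1)
    (hrefl : ∀ x ∈ V, IsZeroOneVec (x + (β - ∑ i, a i * x i) • c)) :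
    HasNiceDescrOfSize
      (convexHull ℝ (V ∪ (fun x => x + (β - ∑ i, a i * x i) • c) '' V)) (m + 2) := by
  obtain ⟨q, s, A, b, C, d, π, hnice⟩ := hm
  obtain ⟨W, hW, hQ, hbij⟩ := hnice.exists_bijOn hV
  let ℓ : (Fin p → ℝ) →ₗ[ℝ] ℝ := ∑ i, a i • LinearMap.proj i
  have hℓ : ∀ x, ∑ i, a i * x i = ℓ x := fun x => by simp [ℓ]
  simp only [hℓ] at hac hslack hrefl ⊢
  let π' : (Fin (q + 1) → ℝ) →ₗ[ℝ] (Fin p → ℝ) :=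
    π ∘ₗ LinearMap.funLeft ℝ ℝ Fin.succ + (LinearMap.proj 0).smulRight c
  have hπ' : ∀ (z : ℝ) (y : Fin q → ℝ), π' (Fin.cons z y) = π y + z • c := fun z y => by
    have : LinearMap.funLeft ℝ ℝ Fin.succ (Fin.cons z y : Fin (q + 1) → ℝ) = y := by
      ext i; simp [LinearMap.funLeft_apply]
    simp [π', this]
  let lower : (Fin q → ℝ) → (Fin (q + 1) → ℝ) := fun y => Fin.cons 0 y
  let upper : (Fin q → ℝ) → (Fin (q + 1) → ℝ) := fun y => Fin.cons (β - ℓ (π y)) y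
  let W' := lower '' W ∪ upper '' W
  have hWslack : ∀ w ∈ W, β - ℓ (π w) = 0 ∨ β - ℓ (π w) = 1 := fun w hw =>
    hslack _ (hbij.mapsTo hw)
  have hW' : ∀ x ∈ W', IsZeroOneVec x := by
    rintro _ (⟨w, hw, rfl⟩ | ⟨w, hw, rfl⟩) i <;> refine Fin.cases ?_ (fun i => ?_) i
    · simp [lower]
    · simpa [lower] using hW w hw i
    · simpa [upper] using hWslack w hw
    · simpa [upper] using hW w hw i
  let A' : Matrix (Fin (m + 2)) (Fin (q + 1)) ℝ :=
    Matrix.of (Fin.cons (Fin.cons (-1) 0) (Fin.cons (Fin.cons 1 fun k => ℓ (π (Pi.single k 1)))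
      fun i => Fin.cons 0 (A i)))
  let b' : Fin (m + 2) → ℝ := Fin.cons 0 (Fin.cons β b)
  let C' : Matrix (Fin s) (Fin (q + 1)) ℝ := Matrix.of fun i => Fin.cons 0 (C i)
  have hdescr : ∀ (z : ℝ) (y : Fin q → ℝ),
      (Fin.cons z y : Fin (q + 1) → ℝ) ∈ {y | A'.mulVec y ≤ b' ∧ C'.mulVec y = d} ↔
        (0 ≤ z ∧ z ≤ β - ℓ (π y)) ∧ y ∈ convexHull ℝ W := by
    intro z y
    have hsum : ∑ k, ℓ (π (Pi.single k 1)) * y k = ℓ (π y) := by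
      have := LinearMap.pi_apply_eq_sum_univ (ℓ ∘ₗ π) y
      simp only [LinearMap.comp_apply, smul_eq_mul] at this
      rw [this]
      refine Finset.sum_congr rfl fun k _ => ?_
      rw [mul_comm]
      congr
      funext l
      simp [Pi.single_apply, eq_comm]
    rw [← hQ]
    simp only [Set.mem_ofPred_eq, Pi.le_def, funext_iff, Fin.forall_fin_succ, Matrix.mulVec,
      dotProduct, Fin.sum_univ_succ, A', b', C', Matrix.of_apply, Fin.cons_zero, Fin.cons_succ,
      Pi.zero_apply, zero_mul, Finset.sum_const_zero, hsum, zero_add, neg_mul, one_mul, add_zero,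
      neg_nonpos, le_sub_iff_add_le]
    tauto
  have hQ' : {y | A'.mulVec y ≤ b' ∧ C'.mulVec y = d} = convexHull ℝ W' := by
    have hconv := convex_convexHull ℝ W'
    apply Set.Subset.antisymm
    · intro y' hy'
      obtain ⟨z, y, rfl⟩ : ∃ z y, y' = Fin.cons z y := ⟨_, _, (Fin.cons_self_tail y').symm⟩
      obtain ⟨⟨hz0, hz1⟩, hy⟩ := (hdescr z y).1 hy'
      have hl : lower y ∈ convexHull ℝ W' := by
        have hsub : W ⊆ lower ⁻¹' convexHull ℝ W' := fun w hw =>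
          subset_convexHull ℝ W' (.inl ⟨w, hw, rfl⟩)
        refine convexHull_min hsub
          (hconv.preimage_of_map_combination fun x y r t _ => ?_) hy
        funext i
        refine Fin.cases ?_ (fun i => ?_) i <;> simp [lower]
      have hu : upper y ∈ convexHull ℝ W' := by
        have hsub : W ⊆ upper ⁻¹' convexHull ℝ W' := fun w hw =>
          subset_convexHull ℝ W' (.inr ⟨w, hw, rfl⟩)
        refine convexHull_min hsub
          (hconv.preimage_of_map_combination fun x y r t hrt => ?_) hy
        obtain rfl : t = 1 - r := by linarith
        funext i
        refine Fin.cases ?_ (fun i => ?_) i <;> simp [upper]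
        ring
      rcases hz0.eq_or_lt with rfl | hz
      · exact hl
      have hpos : 0 < β - ℓ (π y) := hz.trans_le hz1
      have hcomb := hconv hl hu (sub_nonneg.2 ((div_le_one hpos).2 hz1))
        (div_nonneg hz0 hpos.le) (by ring)
      convert hcomb using 1
      funext i
      refine Fin.cases ?_ (fun i => ?_) i <;> simp only [lower, upper, Pi.add_apply,
        Pi.smul_apply, Fin.cons_zero, Fin.cons_succ, smul_eq_mul]
      · field_simp; ring
      · ring
    · refine convexHull_min ?_ ?_
      · rintro _ (⟨w, hw, rfl⟩ | ⟨w, hw, rfl⟩) <;>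
          refine (hdescr _ _).2 ⟨?_, subset_convexHull ℝ W hw⟩ <;>
          rcases hWslack w hw with h | h <;> simp [h]
      · intro x hx y hy r t hr ht hrt
        simp only [Set.mem_ofPred_eq, Matrix.mulVec_add, Matrix.mulVec_smul] at hx hy ⊢
        refine ⟨fun i => ?_, ?_⟩
        · have h1 := mul_le_mul_of_nonneg_left (hx.1 i) hr
          have h2 := mul_le_mul_of_nonneg_left (hy.1 i) ht
          simp only [Pi.add_apply, Pi.smul_apply, smul_eq_mul]
          calc _ ≤ r * b' i + t * b' i := add_le_add h1 h2
            _ = b' i := by rw [← add_mul, hrt, one_mul]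
        · rw [hx.2, hy.2, ← add_smul, hrt, one_smul]
  refine ⟨q + 1, s, A', b', C', d, π', ?_⟩
  rw [hQ']
  refine isNiceExtension_convexHull ?_ hW' ⟨?_, ?_, ?_⟩
  · rintro _ (hx | ⟨x, hx, rfl⟩)
    exacts [hV _ hx, hrefl x hx]
  · rintro _ (⟨w, hw, rfl⟩ | ⟨w, hw, rfl⟩)
    · left
      simpa [lower, hπ'] using hbij.mapsTo hw
    · exact .inr ⟨π w, hbij.mapsTo hw, (hπ' _ _).symm⟩
  · have hform : ∀ x ∈ W', ∃ w ∈ W, ∃ z, (z = 0 ∨ z = β - ℓ (π w)) ∧ x = Fin.cons z w := by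
      rintro _ (⟨w, hw, rfl⟩ | ⟨w, hw, rfl⟩)
      exacts [⟨w, hw, _, .inl rfl, rfl⟩, ⟨w, hw, _, .inr rfl, rfl⟩]
    intro x hx y hy hxy
    obtain ⟨w, hw, z, hz, rfl⟩ := hform x hx
    obtain ⟨w', hw', z', hz', rfl⟩ := hform y hy
    rw [hπ', hπ'] at hxy
    have hval := congrArg ℓ hxy
    simp only [map_add, map_smul, hac, smul_eq_mul] at hval
    obtain rfl : z = z' := by
      rcases hWslack w hw with h | h <;> rcases hWslack w' hw' with h' | h' <;>
        rw [h] at hz <;> rw [h'] at hz' <;> rcases hz with rfl | rfl <;>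
        rcases hz' with rfl | rfl <;> linarith
    rw [hbij.injOn hw hw' (add_right_cancel hxy)]
  · rintro _ (hx | ⟨x, hx, rfl⟩)
    · obtain ⟨w, hw, rfl⟩ := hbij.surjOn hx
      exact ⟨lower w, .inl ⟨w, hw, rfl⟩, by simp [lower, hπ']⟩
    · obtain ⟨w, hw, rfl⟩ := hbij.surjOn hx
      exact ⟨upper w, .inr ⟨w, hw, rfl⟩, hπ' _ _⟩

/-- If `P'` is a nonempty 0/1-polytope, `(a, β)` induces a
symmetry of the cube, `P' ⊆ {x : ⟨a,x⟩ ≤ β}`, and `φ_H` is the reflection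
through `⟨a,x⟩ = β`, then `xcs(conv(P' ∪ φ_H(P'))) ≤ xcs(P') + 2`. -/
theorem stmt6 {p : ℕ} (P' : Set (Fin p → ℝ)) (h01 : IsZeroOnePolytope P') (hne : P'.Nonempty)
    (a : Fin p → ℝ) (β : ℝ) (hsym : InducesCubeSymmetry a β)
    (hsub : ∀ x ∈ P', (∑ i, a i * x i) ≤ β)
    (φ : (Fin p → ℝ) → (Fin p → ℝ))
    (hφ : ∀ x, φ x = x + (2 * (β - ∑ i, a i * x i) / (∑ i, a i ^ 2)) • a) :
    xcs (convexHull ℝ (P' ∪ φ '' P')) ≤ xcs P' + 2 := by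
  have hxcs : HasNiceDescrOfSize P' (xcs P') := Nat.sInf_mem h01.exists_hasNiceDescrOfSize
  obtain ⟨V, hV, rfl⟩ := h01
  have hVle : ∀ x ∈ V, ∑ i, a i * x i ≤ β := fun x hx => hsub x (subset_convexHull ℝ V hx)
  obtain rfl : φ = fun x => x + (β - ∑ i, a i * x i) • (2 / ∑ i, a i ^ 2) • a := by
    funext x
    rw [hφ, smul_smul]
    congr 2
    ring
  have hac : ∑ i, a i * ((2 / ∑ i, a i ^ 2) • a) i = 2 := by
    have hne := hsym.sum_sq_ne_zero
    calc ∑ i, a i * ((2 / ∑ i, a i ^ 2) • a) i = (2 / ∑ i, a i ^ 2) * ∑ i, a i ^ 2 := by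
          rw [Finset.mul_sum]
          refine Finset.sum_congr rfl fun i _ => ?_
          simp only [Pi.smul_apply, smul_eq_mul]
          ring
      _ = 2 := div_mul_cancel₀ _ hne
  have hm := hxcs.convexHull_union_reflection hV hac
    (fun x hx => (hsym.isZeroOneVec_reflection (hV x hx) (hVle x hx)).1)
    (fun x hx => (hsym.isZeroOneVec_reflection (hV x hx) (hVle x hx)).2)
  set φ : (Fin p → ℝ) → (Fin p → ℝ) :=
    fun x => x + (β - ∑ i, a i * x i) • (2 / ∑ i, a i ^ 2) • a with hφdef
  have hcomb : ∀ (x y : Fin p → ℝ) (r t : ℝ), r + t = 1 →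
      φ (r • x + t • y) = r • φ x + t • φ y := by
    intro x y r t hrt
    have hlin : ∑ i, a i * (r • x + t • y) i = r * ∑ i, a i * x i + t * ∑ i, a i * y i := by
      rw [Finset.mul_sum, Finset.mul_sum, ← Finset.sum_add_distrib]
      refine Finset.sum_congr rfl fun i _ => ?_
      simp only [Pi.add_apply, Pi.smul_apply, smul_eq_mul]
      ring
    obtain rfl : t = 1 - r := by linarith
    simp only [hφdef, hlin]
    module
  have hhull : convexHull ℝ (convexHull ℝ V ∪ φ '' convexHull ℝ V) =
      convexHull ℝ (V ∪ φ '' V) := by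
    apply Set.Subset.antisymm
    · refine convexHull_min (Set.union_subset (convexHull_mono Set.subset_union_left) ?_)
        (convex_convexHull ℝ _)
      rw [Set.image_subset_iff]
      exact convexHull_min (fun x hx => subset_convexHull ℝ _ (.inr ⟨x, hx, rfl⟩))
        ((convex_convexHull ℝ _).preimage_of_map_combination hcomb)
    · have := subset_convexHull ℝ V
      exact convexHull_mono (Set.union_subset_union this (Set.image_mono this))
  rw [hhull]
  exact Nat.sInf_le hm
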